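/- Let a, \ell be positive integers, s=(s_1,\dots,s_\ell) a tuple of nonzero integers, and s'=(s_2,\dots,s_\ell). For every prime p \ge a+2, writing H(-)=H(-;p-1), one has H(a,s) \equiv -\frac{1}{a} H\big((a-1)\oplus s_1, s'\big) + \sum_{k=1}^{p-1-a} \binom{p-a}{k} \frac{B_k}{p-a} H\big((k+a-1)\oplus s_1, s'\big) \pmod{p}. -/

import Mathlib

open Finset

/-- sign of an integer as a rational: `-1` if negative, else `1`. -/
def sgn (s : ℤ) : ℚ := if s < 0 then -1 else 1

/-- Auxiliary: alternating multiple harmonic sum with the index list reversed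
    (head of the list corresponds to the outermost, i.e. largest, summation index). -/
def Hrev : List ℤ → ℕ → ℚ
  | [], _ => 1
  | s :: t, n => ∑ k ∈ Finset.Icc 1 n, (sgn s) ^ k / (k : ℚ) ^ s.natAbs * Hrev t (k - 1)

/-- The alternating multiple harmonic sum `H(s₁,…,s_d; n)`:
    the sum over `1 ≤ k₁ < ⋯ < k_d ≤ n` of `∏ sign(sᵢ)^{kᵢ}/kᵢ^{|sᵢ|}`. -/
def H (s : List ℤ) (n : ℕ) : ℚ := Hrev s.reverse n

/-- Auxiliary for the non-strict version. -/
def Srev : List ℤ → ℕ → ℚ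
  | [], _ => 1
  | s :: t, n => ∑ k ∈ Finset.Icc 1 n, (sgn s) ^ k / (k : ℚ) ^ s.natAbs * Srev t k

/-- The non-strict alternating multiple harmonic sum `S(s₁,…,s_d; n)`:
    the sum over `1 ≤ k₁ ≤ ⋯ ≤ k_d ≤ n`. -/
def S (s : List ℤ) (n : ℕ) : ℚ := Srev s.reverse n

/-- `x ≡ y (mod m)` for rationals: the numerator of `x - y` in lowest terms is
    divisible by `m`. -/
def pcong (m : ℕ) (x y : ℚ) : Prop := (m : ℤ) ∣ (x - y).num

/-- The Fermat quotient of 2 : `q_p = (2^{p-1}-1)/p`. -/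
def qp (p : ℕ) : ℚ := (2 ^ (p - 1) - 1) / p

/-- `s ⊕ t = sign(st)(|s|+|t|)`, with the convention that `0 ⊕ t = t` and `s ⊕ 0 = s`. -/
def oplus (s t : ℤ) : ℤ :=
  if s = 0 then t else if t = 0 then s else (s * t).sign * (|s| + |t|)

/-- The rationals whose denominator is prime to `p`. -/
def pIntegers (p : ℕ) [Fact p.Prime] : Subring ℚ :=
  (Rat.padicValuation p).valuationSubring.toSubring

section

variable {p : ℕ} [Fact p.Prime]

lemma mem_pIntegers_iff {x : ℚ} : x ∈ pIntegers p ↔ ¬ p ∣ x.den :=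
  Rat.padicValuation_le_one_iff

lemma inv_natCast_mem_pIntegers {k : ℕ} (hk : 0 < k) (hkp : k < p) :
    ((k : ℚ))⁻¹ ∈ pIntegers p := by
  rw [mem_pIntegers_iff, Rat.inv_natCast_den_of_pos hk]
  exact Nat.not_dvd_of_pos_of_lt hk hkp

lemma dvd_num_of_div_mem_pIntegers {x : ℚ} (hx : x / p ∈ pIntegers p) : (p : ℤ) ∣ x.num := by
  have hp : p.Prime := Fact.out
  have hp0 : (p : ℚ) ≠ 0 := mod_cast hp.ne_zero
  rw [mem_pIntegers_iff] at hx
  have hxy : x = p * (x / p) := by field_simp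
  have h : x.num * (x / p).den = p * (x / p).num * x.den := by
    have h1 : (x.num : ℚ) = x * x.den := (Rat.mul_den_eq_num x).symm
    have h2 : ((x / p).num : ℚ) = x / p * (x / p).den := (Rat.mul_den_eq_num _).symm
    have : (x.num : ℚ) * (x / p).den = p * (x / p).num * x.den := by
      rw [h1, h2]
      nth_rewrite 1 [hxy]
      ring
    exact_mod_cast this
  have hdvd : (p : ℤ) ∣ x.num * (x / p).den := h ▸ ⟨(x / p).num * x.den, by ring⟩
  exact ((Nat.prime_iff_prime_int.mp hp).dvd_or_dvd hdvd).resolve_right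
    fun h' => hx (Int.natCast_dvd_natCast.mp h')

lemma bernoulli'_mem_pIntegers (n : ℕ) (hn : n + 1 < p) : bernoulli' n ∈ pIntegers p := by
  induction n using Nat.strong_induction_on with
  | _ n ih =>
    rw [bernoulli'_def]
    refine sub_mem (one_mem _) (sum_mem fun k hk => ?_)
    have hk := Finset.mem_range.mp hk
    rw [div_eq_mul_inv]
    refine mul_mem (mul_mem (natCast_mem _ _) ?_) (ih k hk (by omega))
    have h : (n : ℚ) - k + 1 = ((n - k + 1 : ℕ) : ℚ) := by
      push_cast [Nat.cast_sub hk.le]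
      ring
    rw [h]
    exact inv_natCast_mem_pIntegers (by omega) (by omega)

lemma bernoulli_mem_pIntegers (n : ℕ) (hn : n + 1 < p) : bernoulli n ∈ pIntegers p :=
  mul_mem (pow_mem (neg_mem (one_mem _)) _) (bernoulli'_mem_pIntegers n hn)

lemma pow_card_sub_one_sub_one_div_mem {l : ℕ} (hl : 0 < l) (hlp : l < p) :
    ((l : ℚ) ^ (p - 1) - 1) / p ∈ pIntegers p := by
  have hp : p.Prime := Fact.out
  have hp0 : (p : ℚ) ≠ 0 := mod_cast hp.ne_zero
  have hco : IsCoprime (l : ℤ) p :=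
    Nat.isCoprime_iff_coprime.mpr (Nat.coprime_of_lt_prime hl.ne' hlp hp).symm
  obtain ⟨c, hc⟩ := (Int.ModEq.pow_card_sub_one_eq_one hp hco).symm.dvd
  have h : ((l : ℚ) ^ (p - 1) - 1) = p * c := mod_cast hc
  rw [h, mul_div_cancel_left₀ _ hp0]
  exact intCast_mem _ _

/-- Fermat's little theorem with negative exponents. -/
lemma pow_sub_inv_pow_div_mem {l m n : ℕ} (hl : 0 < l) (hlp : l < p) (hmn : m + n = p - 1) :
    ((l : ℚ) ^ m - ((l : ℚ)⁻¹) ^ n) / p ∈ pIntegers p := by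
  have hl0 : (l : ℚ) ≠ 0 := mod_cast hl.ne'
  have h : ((l : ℚ) ^ m - ((l : ℚ)⁻¹) ^ n) / p =
      ((l : ℚ) ^ (p - 1) - 1) / p * ((l : ℚ)⁻¹) ^ n := by
    rw [← hmn, pow_add, inv_pow]
    field_simp
  rw [h]
  exact mul_mem (pow_card_sub_one_sub_one_div_mem hl hlp)
    (pow_mem (inv_natCast_mem_pIntegers hl hlp) _)

lemma sgn_mem_pIntegers (s : ℤ) : sgn s ∈ pIntegers p := by
  unfold sgn
  split_ifs
  exacts [neg_mem (one_mem _), one_mem _]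

lemma sgn_pow_div_pow_mem_pIntegers (s : ℤ) (m : ℕ) {k : ℕ} (hk : 0 < k) (hkp : k < p) :
    sgn s ^ k / (k : ℚ) ^ m ∈ pIntegers p := by
  rw [div_eq_mul_inv, ← inv_pow]
  exact mul_mem (pow_mem (sgn_mem_pIntegers s) _) (pow_mem (inv_natCast_mem_pIntegers hk hkp) _)

/-- A linear congruence between harmonic sums persists when larger indices are added. -/
lemma Hrev_append_sub_sum_div_mem (u : List ℤ) (I : Finset ℕ) (c : ℕ → ℚ) (w : ℕ → List ℤ)
    (h : ∀ n < p, (Hrev u n - ∑ i ∈ I, c i * Hrev (w i) n) / p ∈ pIntegers p) (L : List ℤ) :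
    ∀ n < p, (Hrev (L ++ u) n - ∑ i ∈ I, c i * Hrev (L ++ w i) n) / p ∈ pIntegers p := by
  induction L with
  | nil => simpa using h
  | cons s L ih =>
    intro n hn
    have key : (Hrev (s :: L ++ u) n - ∑ i ∈ I, c i * Hrev (s :: L ++ w i) n) / p =
        ∑ k ∈ Finset.Icc 1 n, sgn s ^ k / (k : ℚ) ^ s.natAbs *
          ((Hrev (L ++ u) (k - 1) - ∑ i ∈ I, c i * Hrev (L ++ w i) (k - 1)) / p) := by
      simp only [List.cons_append, Hrev, Finset.mul_sum]
      rw [Finset.sum_comm, ← Finset.sum_sub_distrib, Finset.sum_div]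
      refine Finset.sum_congr rfl fun k _ => ?_
      rw [← mul_div_assoc, mul_sub, Finset.mul_sum]
      congr 2
      exact Finset.sum_congr rfl fun i _ => by ring
    rw [key]
    refine sum_mem fun k hk => ?_
    have hk := Finset.mem_Icc.mp hk
    exact mul_mem (sgn_pow_div_pow_mem_pIntegers s _ (by omega) (by omega)) (ih _ (by omega))

end

lemma sgn_oplus_natCast (m : ℕ) {s : ℤ} (hs : s ≠ 0) : sgn (oplus m s) = sgn s := by
  rcases Nat.eq_zero_or_pos m with rfl | hm
  · simp [oplus]
  · have hm' : (0 : ℤ) < m := mod_cast hm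
    have hpos : 0 < |(m : ℤ)| + |s| := by positivity
    simp only [oplus, hm'.ne', hs, if_false, sgn]
    rw [Int.sign_mul, Int.sign_eq_one_of_pos hm', one_mul]
    rcases lt_or_gt_of_ne hs with h | h
    · rw [Int.sign_eq_neg_one_of_neg h, if_pos (by linarith), if_pos h]
    · rw [Int.sign_eq_one_of_pos h, if_neg (by linarith), if_neg (by linarith)]

lemma natAbs_oplus_natCast (m : ℕ) {s : ℤ} (hs : s ≠ 0) :
    (oplus m s).natAbs = m + s.natAbs := by
  rcases Nat.eq_zero_or_pos m with rfl | hm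
  · simp [oplus]
  · have hm' : (m : ℤ) ≠ 0 := mod_cast hm.ne'
    simp only [oplus, hm', hs, if_false, Int.natAbs_mul,
      Int.natAbs_sign_of_ne_zero (mul_ne_zero hm' hs), one_mul, Int.abs_eq_natAbs]
    omega

/-- The coefficients of the reduction formula, the leading one being `-1 / a`. -/
def reductionCoeff (a p k : ℕ) : ℚ :=
  if k = 0 then -(1 / (a : ℚ)) else (Nat.choose (p - a) k : ℚ) * bernoulli k / ((p : ℚ) - a)

section

variable {p : ℕ} [Fact p.Prime]

lemma choose_mul_bernoulli_div_mem_pIntegers {a k : ℕ} (ha : 0 < a) (hpa : a < p)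
    (hk : k + 1 < p) :
    (Nat.choose (p - a) k : ℚ) * bernoulli k / ((p : ℚ) - a) ∈ pIntegers p := by
  rw [div_eq_mul_inv, ← Nat.cast_sub hpa.le]
  exact mul_mem (mul_mem (natCast_mem _ _) (bernoulli_mem_pIntegers k hk))
    (inv_natCast_mem_pIntegers (by omega) (by omega))

lemma choose_mul_bernoulli_div_sub_reductionCoeff_div_mem {a : ℕ} (ha : 0 < a) (hpa : a < p)
    (k : ℕ) :
    ((Nat.choose (p - a) k : ℚ) * bernoulli k / ((p : ℚ) - a) - reductionCoeff a p k) / p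
      ∈ pIntegers p := by
  unfold reductionCoeff
  split_ifs with hk
  · subst hk
    have hp0 : (p : ℚ) ≠ 0 := mod_cast (by omega : p ≠ 0)
    have ha0 : (a : ℚ) ≠ 0 := mod_cast ha.ne'
    have hpa0 : ((p - a : ℕ) : ℚ) ≠ 0 := mod_cast (by omega : p - a ≠ 0)
    have hcast := Nat.cast_sub (R := ℚ) hpa.le
    have h : ((Nat.choose (p - a) 0 : ℚ) * bernoulli 0 / ((p : ℚ) - a) - -(1 / (a : ℚ))) / p =
        ((p - a : ℕ) : ℚ)⁻¹ * (a : ℚ)⁻¹ := by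
      rw [hcast] at hpa0 ⊢
      simp only [Nat.choose_zero_right, bernoulli_zero, Nat.cast_one]
      field_simp
      ring
    rw [h]
    exact mul_mem (inv_natCast_mem_pIntegers (by omega) (by omega))
      (inv_natCast_mem_pIntegers ha hpa)
  · simp [zero_mem]

/-- Faulhaber's formula for `∑ j ^ (p - 1 - a)`, read modulo `p`. -/
lemma sum_inv_pow_sub_sum_reductionCoeff_div_mem {a l : ℕ} (ha : 0 < a) (hpa : a + 2 ≤ p)
    (hl : 0 < l) (hlp : l < p) :
    (∑ j ∈ Finset.Icc 1 (l - 1), ((j : ℚ)⁻¹) ^ a -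
      ∑ k ∈ Finset.range (p - a), reductionCoeff a p k * ((l : ℚ)⁻¹) ^ (k + a - 1)) / p
      ∈ pIntegers p := by
  have hF := sum_range_pow l (p - 1 - a)
  have hq : p - 1 - a + 1 = p - a := by omega
  have hden : ((p - 1 - a : ℕ) : ℚ) + 1 = (p : ℚ) - a := by
    rw [← Nat.cast_sub (by omega : a ≤ p), ← hq]
    push_cast
    ring
  have hIcc : ∑ j ∈ Finset.range l, (j : ℚ) ^ (p - 1 - a) =
      ∑ j ∈ Finset.Icc 1 (l - 1), (j : ℚ) ^ (p - 1 - a) := by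
    symm
    refine Finset.sum_subset (fun j hj => ?_) fun j hj hj' => ?_
    · simp only [Finset.mem_Icc, Finset.mem_range] at *
      omega
    · simp only [Finset.mem_Icc, Finset.mem_range] at *
      obtain rfl : j = 0 := by omega
      simp
      omega
  rw [hIcc, hq, hden] at hF
  have key : (∑ j ∈ Finset.Icc 1 (l - 1), ((j : ℚ)⁻¹) ^ a -
      ∑ k ∈ Finset.range (p - a), reductionCoeff a p k * ((l : ℚ)⁻¹) ^ (k + a - 1)) / p =
      -(∑ j ∈ Finset.Icc 1 (l - 1), ((j : ℚ) ^ (p - 1 - a) - ((j : ℚ)⁻¹) ^ a) / p) +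
      ∑ k ∈ Finset.range (p - a),
        ((Nat.choose (p - a) k : ℚ) * bernoulli k / ((p : ℚ) - a) *
            (((l : ℚ) ^ (p - a - k) - ((l : ℚ)⁻¹) ^ (k + a - 1)) / p) +
          ((Nat.choose (p - a) k : ℚ) * bernoulli k / ((p : ℚ) - a) - reductionCoeff a p k) / p *
            ((l : ℚ)⁻¹) ^ (k + a - 1)) := by
    have h2 : ∑ k ∈ Finset.range (p - a),
        ((Nat.choose (p - a) k : ℚ) * bernoulli k / ((p : ℚ) - a) *
            (((l : ℚ) ^ (p - a - k) - ((l : ℚ)⁻¹) ^ (k + a - 1)) / p) +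
          ((Nat.choose (p - a) k : ℚ) * bernoulli k / ((p : ℚ) - a) - reductionCoeff a p k) / p *
            ((l : ℚ)⁻¹) ^ (k + a - 1)) =
        (∑ k ∈ Finset.range (p - a),
          bernoulli k * (Nat.choose (p - a) k : ℚ) * (l : ℚ) ^ (p - a - k) / ((p : ℚ) - a) -
        ∑ k ∈ Finset.range (p - a), reductionCoeff a p k * ((l : ℚ)⁻¹) ^ (k + a - 1)) / p := by
      rw [← Finset.sum_sub_distrib, Finset.sum_div]
      exact Finset.sum_congr rfl fun k _ => by ring
    rw [h2, ← hF, ← Finset.sum_div, Finset.sum_sub_distrib]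
    ring
  rw [key]
  refine add_mem (neg_mem (sum_mem fun j hj => ?_)) (sum_mem fun k hk => add_mem ?_ ?_)
  · have hj := Finset.mem_Icc.mp hj
    exact pow_sub_inv_pow_div_mem (by omega) (by omega) (by omega)
  · have hk := Finset.mem_range.mp hk
    exact mul_mem (choose_mul_bernoulli_div_mem_pIntegers ha (by omega) (by omega))
      (pow_sub_inv_pow_div_mem hl hlp (by omega))
  · exact mul_mem (choose_mul_bernoulli_div_sub_reductionCoeff_div_mem ha (by omega) k)
      (pow_mem (inv_natCast_mem_pIntegers hl hlp) _)

lemma Hrev_pair_sub_sum_reductionCoeff_div_mem {a : ℕ} (ha : 0 < a) (hpa : a + 2 ≤ p) {s : ℤ}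
    (hs : s ≠ 0) {n : ℕ} (hn : n < p) :
    (Hrev [s, (a : ℤ)] n - ∑ k ∈ Finset.range (p - a),
      reductionCoeff a p k * Hrev [oplus ((k + a - 1 : ℕ) : ℤ) s] n) / p ∈ pIntegers p := by
  have key : (Hrev [s, (a : ℤ)] n - ∑ k ∈ Finset.range (p - a),
      reductionCoeff a p k * Hrev [oplus ((k + a - 1 : ℕ) : ℤ) s] n) / p =
      ∑ l ∈ Finset.Icc 1 n, sgn s ^ l / (l : ℚ) ^ s.natAbs *
        ((∑ j ∈ Finset.Icc 1 (l - 1), ((j : ℚ)⁻¹) ^ a -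
          ∑ k ∈ Finset.range (p - a), reductionCoeff a p k * ((l : ℚ)⁻¹) ^ (k + a - 1)) / p) := by
    have hsgn : sgn (a : ℤ) = 1 := if_neg (by omega)
    simp only [Hrev, mul_one, sgn_oplus_natCast _ hs, natAbs_oplus_natCast _ hs, Finset.mul_sum,
      hsgn, one_pow, Int.natAbs_natCast, one_div, inv_pow]
    rw [Finset.sum_comm (s := Finset.range (p - a)), ← Finset.sum_sub_distrib, Finset.sum_div]
    refine Finset.sum_congr rfl fun l _ => ?_
    rw [← mul_div_assoc, mul_sub, Finset.mul_sum, Finset.mul_sum]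
    congr 2
    refine Finset.sum_congr rfl fun k _ => ?_
    rw [pow_add]
    simp only [div_eq_mul_inv, mul_inv]
    ring
  rw [key]
  refine sum_mem fun l hl => ?_
  have hl := Finset.mem_Icc.mp hl
  exact mul_mem (sgn_pow_div_pow_mem_pIntegers s _ (by omega) (by omega))
    (sum_inv_pow_sub_sum_reductionCoeff_div_mem ha hpa (by omega) (by omega))

end

/-- First reduction formula (Theorem for `H(a, s)` with positive leading entry). -/
theorem reduction_formula_positive (a : ℕ) (ha : 0 < a) (s1 : ℤ) (hs1 : s1 ≠ 0)
    (s' : List ℤ) (hs' : ∀ t ∈ s', t ≠ 0) (p : ℕ) (hp : p.Prime) (hpa : a + 2 ≤ p) :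
    pcong p (H ((a : ℤ) :: s1 :: s') (p - 1))
      (-(1 / (a : ℚ)) * H (oplus ((a : ℤ) - 1) s1 :: s') (p - 1) +
        ∑ k ∈ Finset.Icc 1 (p - 1 - a),
          (Nat.choose (p - a) k : ℚ) * bernoulli k / ((p : ℚ) - a) *
            H (oplus ((k : ℤ) + a - 1) s1 :: s') (p - 1)) := by
  have : Fact p.Prime := ⟨hp⟩
  refine dvd_num_of_div_mem_pIntegers ?_
  have h := Hrev_append_sub_sum_div_mem [s1, (a : ℤ)] (Finset.range (p - a)) (reductionCoeff a p)
    (fun k => [oplus ((k + a - 1 : ℕ) : ℤ) s1])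
    (fun n hn => Hrev_pair_sub_sum_reductionCoeff_div_mem ha hpa hs1 hn) s'.reverse
    (p - 1) (by omega)
  have hcast (k : ℕ) : ((k + a - 1 : ℕ) : ℤ) = (k : ℤ) + a - 1 := by omega
  convert h using 3
  · simp [H]
  · rw [Finset.range_eq_Ico, Finset.sum_eq_sum_Ico_succ_bot (by omega)]
    congr 1
    · simp [reductionCoeff, H, Nat.cast_sub (Nat.one_le_iff_ne_zero.mpr ha.ne')]
    · have hI : Finset.Ico (0 + 1) (p - a) = Finset.Icc 1 (p - 1 - a) := by
        ext k
        simp only [Finset.mem_Ico, Finset.mem_Icc]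
        omega
      rw [hI]
      refine Finset.sum_congr rfl fun k hk => ?_
      have hk0 : k ≠ 0 := by
        have := Finset.mem_Icc.mp hk
        omega
      simp [reductionCoeff, hk0, H, hcast]
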